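/- Lebesgue almost every M ∈ M_{m,(m+n)}(ℝ) satisfies β(M) = n/m, where β(M) := sup { β ≥ 0 : there are infinitely many q ∈ ℤ^{m+n} with ‖M·q‖ < ‖q‖^{-β} }. -/

import Mathlib

open scoped ENNReal

noncomputable def euclNorm {d : ℕ} (v : Fin d → ℝ) : ℝ :=
  ‖(WithLp.equiv 2 (Fin d → ℝ)).symm v‖

def approxSet (m n : ℕ) (M : Matrix (Fin m) (Fin (m + n)) ℝ) (b : ℝ) :
    Set (Fin (m + n) → ℤ) :=
  {q | euclNorm (M.mulVec fun i => (q i : ℝ)) < euclNorm (fun i => ((q i : ℝ))) ^ (-b)}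

noncomputable def dioExp (m n : ℕ) (M : Matrix (Fin m) (Fin (m + n)) ℝ) : ℝ≥0∞ :=
  sSup {x : ℝ≥0∞ | ∃ b : ℝ, 0 ≤ b ∧ x = ENNReal.ofReal b ∧ (approxSet m n M b).Infinite}

def IsRationalSubspace {d : ℕ} (W : Submodule ℝ (Fin d → ℝ)) : Prop :=
  ∃ s : Set (Fin d → ℚ), W = Submodule.span ℝ ((fun v : Fin d → ℚ => fun i => ((v i : ℝ))) '' s)

def pencil (m n : ℕ) (W : Submodule ℝ (Fin (m + n) → ℝ)) (r : ℕ) :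
    Set (Matrix (Fin m) (Fin (m + n)) ℝ) :=
  {M | Module.finrank ℝ (W.map M.mulVecLin) ≤ r}

section EuclideanNorm

variable {d : ℕ}

theorem euclNorm_nonneg (v : Fin d → ℝ) : 0 ≤ euclNorm v := norm_nonneg _

theorem euclNorm_zero : euclNorm (0 : Fin d → ℝ) = 0 := by
  simp [euclNorm]

theorem norm_le_euclNorm (v : Fin d → ℝ) : ‖v‖ ≤ euclNorm v :=
  (pi_norm_le_iff_of_nonneg (euclNorm_nonneg v)).2 fun i =>
    PiLp.norm_apply_le ((WithLp.equiv 2 (Fin d → ℝ)).symm v) i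

theorem euclNorm_le_mul_norm (v : Fin d → ℝ) : euclNorm v ≤ d * ‖v‖ := by
  rw [euclNorm, EuclideanSpace.norm_eq]
  refine Real.sqrt_le_iff.2 ⟨by positivity, ?_⟩
  have hle : ∀ i : Fin d, ‖v i‖ ^ 2 ≤ ‖v‖ ^ 2 := fun i => by
    gcongr
    exact norm_le_pi_norm v i
  have hd : (d : ℝ) ≤ (d : ℝ) ^ 2 := by exact_mod_cast Nat.le_self_pow two_ne_zero d
  calc ∑ i, ‖v i‖ ^ 2 ≤ ∑ _i : Fin d, ‖v‖ ^ 2 := Finset.sum_le_sum fun i _ => hle i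
    _ = d * ‖v‖ ^ 2 := by simp
    _ ≤ (d : ℝ) ^ 2 * ‖v‖ ^ 2 := by gcongr
    _ = (d * ‖v‖) ^ 2 := by ring

theorem one_le_norm_intCast {q : Fin d → ℤ} (hq : q ≠ 0) : 1 ≤ ‖fun i => (q i : ℝ)‖ := by
  obtain ⟨i, hi⟩ := Function.ne_iff.1 hq
  refine le_trans ?_ (norm_le_pi_norm (fun i => (q i : ℝ)) i)
  rw [Real.norm_eq_abs]
  exact_mod_cast Int.one_le_abs hi

theorem euclNorm_intCast_zero : euclNorm (fun i => (((0 : Fin d → ℤ) i : ℤ) : ℝ)) = 0 := by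
  simpa [Pi.zero_def] using euclNorm_zero (d := d)

end EuclideanNorm

theorem approxSet_anti {m n : ℕ} (M : Matrix (Fin m) (Fin (m + n)) ℝ) {b c : ℝ} (hb : 0 < b)
    (hbc : b ≤ c) : approxSet m n M c ⊆ approxSet m n M b := by
  intro q hq
  rcases eq_or_ne q 0 with rfl | h
  · simp only [approxSet, Set.mem_ofPred_eq, euclNorm_intCast_zero] at hq
    rw [Real.zero_rpow (by linarith)] at hq
    exact absurd hq (euclNorm_nonneg _).not_gt
  · exact lt_of_lt_of_le hq (Real.rpow_le_rpow_of_exponent_le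
      ((one_le_norm_intCast h).trans (norm_le_euclNorm _)) (by linarith))

section UpperBound

open MeasureTheory

theorem summable_norm_intCast_rpow {d : ℕ} {r : ℝ} (hr : r < -d) :
    Summable fun q : Fin d → ℤ => ‖fun i => (q i : ℝ)‖ ^ r := by
  let L := Submodule.span ℤ (Set.range (Pi.basisFun ℝ (Fin d)))
  have hL : Module.finrank ℤ L = d := by
    rw [ZLattice.rank ℝ L]; simp
  have hmem : ∀ q : Fin d → ℤ, (fun i => (q i : ℝ)) ∈ L := fun q => by
    rw [Module.Basis.mem_span_iff_repr_mem]
    intro i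
    simp
  have hs := ZLattice.summable_norm_rpow L r (by rw [hL]; exact hr)
  refine hs.comp_injective (i := fun q : Fin d → ℤ => (⟨_, hmem q⟩ : L)) ?_
  intro q q' h
  funext i
  have := congrFun (congrArg Subtype.val h) i
  simpa using this

/-- A thin slab around the hyperplane orthogonal to `v` meets a cube in a set of small volume. -/
theorem volume_cube_inter_slab_le {d : ℕ} {v : Fin d → ℝ} (hv : v ≠ 0) {R ε : ℝ}
    (hR : 0 ≤ R) :
    volume {a : Fin d → ℝ | (∀ j, |a j| ≤ R) ∧ |∑ j, a j * v j| ≤ ε} ≤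
      ENNReal.ofReal ((2 * R) ^ (d - 1) * (2 * ε) * ‖v‖⁻¹) := by
  have hne : Nonempty (Fin d) := by
    obtain ⟨i, -⟩ := Function.ne_iff.1 hv
    exact ⟨i⟩
  obtain ⟨k, hk⟩ : ∃ k, ‖v‖ = |v k| := by
    obtain ⟨k, hk⟩ := Finite.exists_max fun i => |v i|
    exact ⟨k, le_antisymm ((pi_norm_le_iff_of_nonneg (abs_nonneg _)).2 hk) (norm_le_pi_norm v k)⟩
  let T : Matrix (Fin d) (Fin d) ℝ := (1 : Matrix (Fin d) (Fin d) ℝ).updateRow k v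
  have hdet : LinearMap.det (Matrix.toLin' T) = v k := by
    rw [LinearMap.det_toLin', ← Matrix.cramer_transpose_apply]
    simp
  have hvk : v k ≠ 0 := by
    rw [← abs_pos, ← hk]; exact norm_pos_iff.2 hv
  let u : Fin d → ℝ := Function.update (fun _ => R) k ε
  have hsub : {a : Fin d → ℝ | (∀ j, |a j| ≤ R) ∧ |∑ j, a j * v j| ≤ ε} ⊆
      Matrix.toLin' T ⁻¹' Set.Icc (-u) u := by
    rintro a ⟨ha, hav⟩
    have key : ∀ i, |Matrix.toLin' T a i| ≤ u i := by
      intro i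
      rw [Matrix.toLin'_apply]
      rcases eq_or_ne i k with rfl | hi
      · simpa [T, u, Matrix.mulVec, dotProduct, mul_comm] using hav
      · simpa [T, u, Matrix.mulVec, dotProduct, hi, Matrix.one_apply] using ha i
    exact ⟨fun i => (abs_le.1 (key i)).1, fun i => (abs_le.1 (key i)).2⟩
  refine (measure_mono hsub).trans ?_
  rw [Measure.addHaar_preimage_linearMap _ (by rw [hdet]; exact hvk), hdet, Real.volume_Icc_pi,
    ← Finset.mul_prod_erase _ _ (Finset.mem_univ k)]
  have hprod : ∏ i ∈ Finset.univ.erase k, ENNReal.ofReal (u i - (-u) i) =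
      ENNReal.ofReal ((2 * R) ^ (d - 1)) := by
    rw [Finset.prod_congr rfl fun i hi => by
      rw [Pi.neg_apply, show u i = R from Function.update_of_ne (Finset.ne_of_mem_erase hi) _ _]]
    rw [Finset.prod_const, Finset.card_erase_of_mem (Finset.mem_univ k), ENNReal.ofReal_pow]
    · simp [two_mul]
    · positivity
  rw [hprod, Pi.neg_apply, show u k = ε from Function.update_self _ _ _, abs_inv, ← hk,
    mul_comm, mul_comm (ENNReal.ofReal (ε - -ε)), ENNReal.ofReal_mul' (by positivity),
    ENNReal.ofReal_mul (by positivity), sub_neg_eq_add, ← two_mul]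

theorem volume_cube_inter_approx_le {m n : ℕ} {b : ℝ} (hb : 0 < b) {R : ℝ} (hR : 0 ≤ R)
    (q : Fin (m + n) → ℤ) :
    volume {A : Fin m → Fin (m + n) → ℝ |
        (∀ i j, |A i j| ≤ R) ∧ q ∈ approxSet m n (Matrix.of A) b} ≤
      ENNReal.ofReal (((2 * R) ^ (m + n - 1) * 2) ^ m *
        ‖fun i => (q i : ℝ)‖ ^ (-((b + 1) * m))) := by
  rcases eq_or_ne q 0 with rfl | hq
  · refine (le_of_eq ?_).trans zero_le
    convert measure_empty (μ := volume)
    refine Set.eq_empty_of_forall_notMem fun A hA => ?_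
    have := hA.2
    simp only [approxSet, Set.mem_ofPred_eq, euclNorm_intCast_zero] at this
    rw [Real.zero_rpow (by linarith)] at this
    exact absurd this (euclNorm_nonneg _).not_gt
  set v : Fin (m + n) → ℝ := fun i => (q i : ℝ) with hv
  have hv1 : 1 ≤ ‖v‖ := one_le_norm_intCast hq
  have hv0 : 0 < ‖v‖ := one_pos.trans_le hv1
  have hsub : {A : Fin m → Fin (m + n) → ℝ |
        (∀ i j, |A i j| ≤ R) ∧ q ∈ approxSet m n (Matrix.of A) b} ⊆
      Set.univ.pi fun _ : Fin m =>
        {a : Fin (m + n) → ℝ | (∀ j, |a j| ≤ R) ∧ |∑ j, a j * v j| ≤ ‖v‖ ^ (-b)} := by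
    rintro A ⟨hA, hqA⟩ i -
    refine ⟨hA i, ?_⟩
    calc |∑ j, A i j * v j| ≤ ‖(Matrix.of A).mulVec v‖ := norm_le_pi_norm ((Matrix.of A).mulVec v) i
      _ ≤ euclNorm ((Matrix.of A).mulVec v) := norm_le_euclNorm _
      _ ≤ euclNorm v ^ (-b) := le_of_lt hqA
      _ ≤ ‖v‖ ^ (-b) :=
        Real.rpow_le_rpow_of_nonpos hv0 (norm_le_euclNorm v) (by linarith)
  refine (measure_mono hsub).trans ?_
  rw [volume_pi_pi, Finset.prod_const, Finset.card_univ, Fintype.card_fin]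
  refine (pow_le_pow_left' (volume_cube_inter_slab_le (norm_pos_iff.1 hv0) hR) m).trans ?_
  rw [← ENNReal.ofReal_pow (by positivity)]
  refine ENNReal.ofReal_le_ofReal (le_of_eq ?_)
  rw [neg_mul_eq_neg_mul, Real.rpow_mul_natCast hv0.le, ← mul_pow, neg_add, Real.rpow_add hv0,
    Real.rpow_neg_one]
  ring

theorem ae_finite_approxSet {m n : ℕ} (hm : m ≠ 0) {b : ℝ} (hb : (n : ℝ) / m < b) :
    ∀ᵐ A : Fin m → Fin (m + n) → ℝ ∂volume, (approxSet m n (Matrix.of A) b).Finite := by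
  have hm' : (0 : ℝ) < m := by exact_mod_cast Nat.pos_of_ne_zero hm
  have hb0 : 0 < b := lt_of_le_of_lt (by positivity) hb
  have hR : ∀ R : ℕ, ∀ᵐ A : Fin m → Fin (m + n) → ℝ ∂volume,
      (∀ i j, |A i j| ≤ R) → (approxSet m n (Matrix.of A) b).Finite := by
    intro R
    have hsum : Summable fun q : Fin (m + n) → ℤ =>
        ((2 * (R : ℝ)) ^ (m + n - 1) * 2) ^ m * ‖fun i => (q i : ℝ)‖ ^ (-((b + 1) * m)) := by
      refine (summable_norm_intCast_rpow ?_).mul_left _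
      rw [div_lt_iff₀ hm'] at hb
      push_cast
      linarith
    have hfin := ae_finite_setOfPred_mem (ne_top_of_le_ne_top hsum.tsum_ofReal_ne_top
      (ENNReal.tsum_le_tsum fun q =>
        volume_cube_inter_approx_le (m := m) (n := n) hb0 R.cast_nonneg q))
    filter_upwards [hfin] with A hA hAR
    exact hA.subset fun q hq => ⟨hAR, hq⟩
  filter_upwards [ae_all_iff.2 hR] with A hA
  obtain ⟨R, hR⟩ := exists_nat_ge ‖A‖
  exact hA R fun i j => ((norm_le_pi_norm (A i) j).trans (norm_le_pi_norm A i)).trans hR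

end UpperBound

section LowerBound

open Filter Topology

/-- The Dirichlet approximation theorem for a system of linear forms. -/
theorem exists_int_norm_mulVec_le {m n : ℕ} (hm : m ≠ 0) (M : Matrix (Fin m) (Fin (m + n)) ℝ) :
    ∃ C : ℝ, 0 < C ∧ ∀ s : ℕ, 0 < s → ∃ q : Fin (m + n) → ℤ, q ≠ 0 ∧
      ‖fun i => (q i : ℝ)‖ ≤ 3 * (s : ℝ) ^ m ∧
      ‖M.mulVec fun i => (q i : ℝ)‖ ≤ C / (s : ℝ) ^ n := by
  let K : ℝ := 1 + ∑ i, ∑ j, |M i j|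
  have hK : 0 < K := by positivity
  refine ⟨3 * K, by positivity, fun s hs => ?_⟩
  have hs' : (0 : ℝ) < s := by exact_mod_cast hs
  let Q : ℕ := 3 * s ^ m
  let P : ℕ := s ^ (m + n)
  let ε : ℝ := 3 * K / (s : ℝ) ^ n
  have hε : 0 < ε := by positivity
  have hQP : K * Q = ε * P := by
    simp only [Q, P, ε]
    push_cast
    rw [pow_add]
    field_simp
  let S : Finset (Fin (m + n) → ℤ) := Fintype.piFinset fun _ => Finset.Icc 0 (Q : ℤ)
  let B : Finset (Fin m → ℤ) := Fintype.piFinset fun _ => Finset.Icc (-(P : ℤ)) P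
  let f : (Fin (m + n) → ℤ) → Fin m → ℤ := fun x i =>
    ⌊M.mulVec (fun j => (x j : ℝ)) i / ε⌋
  have hcard : B.card < S.card := by
    have hP : 1 ≤ P := Nat.one_le_pow _ _ hs
    have hB : B.card = (2 * P + 1) ^ m := by
      simp only [B, Fintype.card_piFinset, Int.card_Icc, Finset.prod_const, Finset.card_univ,
        Fintype.card_fin]
      congr 1
      omega
    have hS : S.card = (Q + 1) ^ (m + n) := by
      simp only [S, Fintype.card_piFinset, Int.card_Icc, Finset.prod_const, Finset.card_univ,
        Fintype.card_fin]
      congr 1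
    rw [hB, hS]
    calc (2 * P + 1) ^ m ≤ (3 * P) ^ m := Nat.pow_le_pow_left (by omega) m
      _ = 3 ^ m * (s ^ m) ^ (m + n) := by rw [mul_pow, ← pow_mul, ← pow_mul, mul_comm m]
      _ ≤ 3 ^ (m + n) * (s ^ m) ^ (m + n) := by gcongr <;> omega
      _ = Q ^ (m + n) := (mul_pow _ _ _).symm
      _ < (Q + 1) ^ (m + n) := Nat.pow_lt_pow_left (Nat.lt_succ_self Q) (by omega)
  have hmaps : Set.MapsTo f S B := by
    intro x hx
    have hx' : ∀ j, 0 ≤ x j ∧ x j ≤ Q := fun j =>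
    Finset.mem_Icc.1 (Fintype.mem_piFinset.1 hx j)
    have hbound : ∀ i, |M.mulVec (fun j => (x j : ℝ)) i| ≤ ε * P := by
      intro i
      rw [← hQP]
      calc |∑ j, M i j * (x j : ℝ)| ≤ ∑ j, |M i j * (x j : ℝ)| :=
            Finset.abs_sum_le_sum_abs _ _
        _ ≤ ∑ j, |M i j| * Q := by
          refine Finset.sum_le_sum fun j _ => ?_
          rw [abs_mul]
          gcongr
          rw [abs_of_nonneg (by exact_mod_cast (hx' j).1)]
          exact_mod_cast (hx' j).2
        _ = (∑ j, |M i j|) * Q := (Finset.sum_mul _ _ _).symm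
        _ ≤ K * Q := by
          gcongr
          have := Finset.single_le_sum (f := fun i => ∑ j, |M i j|)
            (fun i _ => Finset.sum_nonneg fun j _ => abs_nonneg _) (Finset.mem_univ i)
          simp only [K]
          linarith
    simp only [B, Finset.mem_coe, Fintype.mem_piFinset, Finset.mem_Icc]
    intro i
    obtain ⟨h1, h2⟩ := abs_le.1 (hbound i)
    constructor
    · refine Int.le_floor.2 ?_
      rw [le_div_iff₀ hε]
      push_cast
      linarith
    · have : ((f x i : ℤ) : ℝ) ≤ P :=
        (Int.floor_le _).trans ((div_le_iff₀ hε).2 (by linarith))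
      exact_mod_cast this
  obtain ⟨x, hx, y, hy, hxy, hfxy⟩ :=
    Finset.exists_ne_map_eq_of_card_lt_of_maps_to hcard hmaps
  have hx' : ∀ j, 0 ≤ x j ∧ x j ≤ Q := fun j =>
    Finset.mem_Icc.1 (Fintype.mem_piFinset.1 hx j)
  have hy' : ∀ j, 0 ≤ y j ∧ y j ≤ Q := fun j =>
    Finset.mem_Icc.1 (Fintype.mem_piFinset.1 hy j)
  refine ⟨x - y, sub_ne_zero.2 hxy, ?_, ?_⟩
  · refine (pi_norm_le_iff_of_nonneg (by positivity)).2 fun j => ?_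
    have h : |x j - y j| ≤ Q := abs_le.2 ⟨by linarith [hx' j, hy' j], by linarith [hx' j, hy' j]⟩
    rw [Real.norm_eq_abs, Pi.sub_apply]
    have h' : ((|x j - y j| : ℤ) : ℝ) ≤ ((Q : ℤ) : ℝ) := Int.cast_le.2 h
    simpa [Q] using h'
  · refine (pi_norm_le_iff_of_nonneg hε.le).2 fun i => ?_
    have hsub : (fun j => (((x - y) j : ℤ) : ℝ)) = (fun j => (x j : ℝ)) - fun j => (y j : ℝ) := by
      funext j
      simp
    have h := Int.abs_sub_lt_one_of_floor_eq_floor (congrFun hfxy i)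
    rw [← sub_div, abs_div, abs_of_pos hε, div_lt_one hε] at h
    rw [hsub, Matrix.mulVec_sub]
    exact h.le

theorem infinite_approxSet {m n : ℕ} (hm : m ≠ 0) (hn : n ≠ 0)
    (M : Matrix (Fin m) (Fin (m + n)) ℝ) {b : ℝ} (hb0 : 0 ≤ b) (hb : b < (n : ℝ) / m) :
    (approxSet m n M b).Infinite := by
  by_cases hker : ∃ q : Fin (m + n) → ℤ, q ≠ 0 ∧ M.mulVec (fun i => (q i : ℝ)) = 0
  · obtain ⟨q, hq, hMq⟩ := hker
    obtain ⟨j, hj⟩ := Function.ne_iff.1 hq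
    refine Set.infinite_of_injective_forall_mem (f := fun k : ℕ => ((k : ℤ) + 1) • q) ?_ ?_
    · intro k l hkl
      have := congrFun hkl j
      simpa [show q j ≠ 0 from hj] using this
    · intro k
      have hne : ((k : ℤ) + 1) • q ≠ 0 := smul_ne_zero (by positivity) hq
      have hcast : (fun i => (((((k : ℤ) + 1) • q) i : ℤ) : ℝ)) =
          ((k : ℝ) + 1) • fun i => (q i : ℝ) := by
        funext i
        simp
      have hpos := one_pos.trans_le ((one_le_norm_intCast hne).trans (norm_le_euclNorm _))
      rw [approxSet, Set.mem_ofPred_eq]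
      refine lt_of_eq_of_lt ?_ (Real.rpow_pos_of_pos hpos _)
      rw [hcast, Matrix.mulVec_smul, hMq, smul_zero, euclNorm_zero]
  · push Not at hker
    have hm' : (0 : ℝ) < m := by exact_mod_cast Nat.pos_of_ne_zero hm
    have hn' : (0 : ℝ) < n := by exact_mod_cast Nat.pos_of_ne_zero hn
    intro hfin
    obtain ⟨C, hC, hdir⟩ := exists_int_norm_mulVec_le hm M
    obtain ⟨δ, hδ, hδle⟩ : ∃ δ : ℝ, 0 < δ ∧ ∀ q ∈ approxSet m n M b, q ≠ 0 →
        δ ≤ ‖M.mulVec fun i => (q i : ℝ)‖ := by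
      have hfin' : (approxSet m n M b \ {0}).Finite := hfin.subset Set.sdiff_subset
      rcases (approxSet m n M b \ {0}).eq_empty_or_nonempty with he | hne
      · refine ⟨1, one_pos, fun q hq hq0 => ?_⟩
        exact absurd (show q ∈ approxSet m n M b \ {0} from ⟨hq, hq0⟩) (he ▸ Set.notMem_empty q)
      · obtain ⟨p, hp, hmin⟩ :=
          Set.exists_min_image _ (fun q => ‖M.mulVec fun i => (q i : ℝ)‖) hfin' hne
        exact ⟨_, norm_pos_iff.2 (hker p hp.2), fun q hq hq0 => hmin q ⟨hq, hq0⟩⟩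
    have hlim1 : Tendsto (fun s : ℕ => C * (s : ℝ) ^ (-(n : ℝ))) atTop (𝓝 0) := by
      simpa using ((tendsto_rpow_neg_atTop hn').comp tendsto_natCast_atTop_atTop).const_mul C
    have hgap : 0 < (n : ℝ) - m * b := by
      rw [lt_div_iff₀ hm'] at hb
      linarith
    have hlim2 : Tendsto (fun s : ℕ => (m * C) * (s : ℝ) ^ (-((n : ℝ) - m * b))) atTop (𝓝 0) := by
      simpa using
        ((tendsto_rpow_neg_atTop hgap).comp tendsto_natCast_atTop_atTop).const_mul (m * C)
    let D : ℝ := ((m + n : ℕ) : ℝ) * 3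
    have hD : 0 < D := by simp only [D]; push_cast; positivity
    obtain ⟨s, hs1, hs2, hs⟩ := ((hlim1.eventually_lt_const hδ).and
      ((hlim2.eventually_lt_const (Real.rpow_pos_of_pos hD (-b))).and
        (eventually_gt_atTop 0))).exists
    have hs' : (0 : ℝ) < s := by exact_mod_cast hs
    obtain ⟨q, hq, hqs, hMq⟩ := hdir s hs
    have hMq' : ‖M.mulVec fun i => (q i : ℝ)‖ ≤ C * (s : ℝ) ^ (-(n : ℝ)) := by
      rwa [Real.rpow_neg hs'.le, Real.rpow_natCast, ← div_eq_mul_inv]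
    refine (hs1.trans_le (hδle q ?_ hq)).not_ge hMq'
    have hq1 : 0 < euclNorm fun i => (q i : ℝ) :=
      one_pos.trans_le ((one_le_norm_intCast hq).trans (norm_le_euclNorm _))
    calc euclNorm (M.mulVec fun i => (q i : ℝ))
        ≤ m * (C * (s : ℝ) ^ (-(n : ℝ))) :=
          (euclNorm_le_mul_norm _).trans (by gcongr)
      _ = (m * C * (s : ℝ) ^ (-((n : ℝ) - m * b))) * (s : ℝ) ^ (-(m * b)) := by
        rw [mul_assoc (m * C : ℝ), ← Real.rpow_add hs', mul_assoc]
        ring_nf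
      _ < D ^ (-b) * (s : ℝ) ^ (-(m * b)) := by gcongr
      _ = (D * (s : ℝ) ^ m) ^ (-b) := by
        rw [Real.mul_rpow hD.le (by positivity), ← Real.rpow_natCast, ← Real.rpow_mul hs'.le,
          mul_neg]
      _ ≤ euclNorm (fun i => (q i : ℝ)) ^ (-b) := by
        refine Real.rpow_le_rpow_of_nonpos hq1 ?_ (by linarith)
        refine (euclNorm_le_mul_norm _).trans ?_
        rw [mul_assoc]
        gcongr

end LowerBound

theorem stmt9 (m n : ℕ) (hm : 1 ≤ m) (hn : 1 ≤ n) :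
    ∀ᵐ A : Fin m → Fin (m + n) → ℝ ∂MeasureTheory.volume,
      dioExp m n (Matrix.of A) = ENNReal.ofReal ((n : ℝ) / m) := by
  have hm0 : m ≠ 0 := Nat.one_le_iff_ne_zero.1 hm
  have hn0 : n ≠ 0 := Nat.one_le_iff_ne_zero.1 hn
  have hfin : ∀ᵐ A : Fin m → Fin (m + n) → ℝ ∂MeasureTheory.volume, ∀ k : ℕ,
      (approxSet m n (Matrix.of A) ((n : ℝ) / m + 1 / ((k : ℝ) + 1))).Finite :=
    MeasureTheory.ae_all_iff.2 fun k =>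
      ae_finite_approxSet hm0 (lt_add_of_pos_right _ Nat.one_div_pos_of_nat)
  filter_upwards [hfin] with A hA
  apply le_antisymm
  · refine sSup_le ?_
    rintro x ⟨b, -, rfl, hinf⟩
    refine ENNReal.ofReal_le_ofReal (not_lt.1 fun hb => ?_)
    obtain ⟨k, hk⟩ := exists_nat_one_div_lt (sub_pos.2 hb)
    exact hinf ((hA k).subset (approxSet_anti _ (by positivity) (by linarith)))
  · refine le_of_forall_lt fun x hx => ?_
    obtain ⟨y, hxy, hy⟩ := exists_between hx
    have hy' : y = ENNReal.ofReal y.toReal :=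
      (ENNReal.ofReal_toReal (hy.trans ENNReal.ofReal_lt_top).ne).symm
    refine hxy.trans_le (le_sSup ⟨y.toReal, ENNReal.toReal_nonneg, hy', ?_⟩)
    refine infinite_approxSet hm0 hn0 _ ENNReal.toReal_nonneg ?_
    rw [hy'] at hy
    exact (ENNReal.ofReal_lt_ofReal_iff (by positivity)).1 hy
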